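/- arXiv:1804.09887 — 5 statements merged into one kernel-verified Lean document; each statement's English description precedes it below -/
import Mathlib

section
/- For every φ ∈ Φ and every z ∈ ℝ^m, the number ‖z‖₀ of nonzero entries of z equals the minimum of Σ_{i=1}^m φ(w_i) over all w ∈ ℝ^m satisfying 0 ≤ w_i ≤ 1 for all i and ‖z‖₁ − Σ_{i=1}^m w_i|z_i| = 0, and this minimum is attained. -/
open scoped BigOperators
open Classical

noncomputable section

/-- Convexity for extended-real-valued functions on `ℝ`. -/
def ERealConvexOn (φ : ℝ → EReal) : Prop :=
  ∀ x y t : ℝ, 0 ≤ t → t ≤ 1 →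
    φ (t * x + (1 - t) * y) ≤ (t : EReal) * φ x + ((1 - t : ℝ) : EReal) * φ y

/-- The subdifferential of a convex function `φ : ℝ → EReal` at a point `t`. -/
def subdiff (φ : ℝ → EReal) (t : ℝ) : Set ℝ :=
  {g : ℝ | ∀ s : ℝ, φ t + ((g * (s - t) : ℝ) : EReal) ≤ φ s}

/-- The left derivative `φ'₋(t)` of a convex function (the infimum of its subdifferential). -/
def leftDeriv (φ : ℝ → EReal) (t : ℝ) : ℝ := sInf (subdiff φ t)

/-- `φ` belongs to the family `Φ`, with distinguished unique minimizer `tstar` of `φ` on `[0,1]`: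
`φ` is a lower semicontinuous proper convex function, `[0,1] ⊆ int(dom φ)`, `φ(1) = 1`,
and `φ(tstar) = 0`. -/
structure MemPhi (φ : ℝ → EReal) (tstar : ℝ) : Prop where
  lsc : LowerSemicontinuous φ
  convex : ERealConvexOn φ
  proper : ∀ t, φ t ≠ ⊥
  domInt : Set.Icc (0:ℝ) 1 ⊆ interior {t | φ t ≠ ⊤}
  phiOne : φ 1 = 1
  tstarMem : tstar ∈ Set.Icc (0:ℝ) 1
  tstarMin : ∀ t ∈ Set.Icc (0:ℝ) 1, t ≠ tstar → φ tstar < φ t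
  phiTstar : φ tstar = 0

/-- `tbar` is the minimal element of `[tstar, 1)` with `1/(1 - tstar) ∈ ∂φ(tbar)`. -/
def IsTbar (φ : ℝ → EReal) (tstar tbar : ℝ) : Prop :=
  tbar ∈ Set.Ico tstar 1 ∧ (1 / (1 - tstar)) ∈ subdiff φ tbar ∧
    ∀ t ∈ Set.Ico tstar 1, (1 / (1 - tstar)) ∈ subdiff φ t → tbar ≤ t

/-- A partition of `{1,…,p}` into `m` nonempty groups. -/
structure GroupStructure (p m : ℕ) where
  J : Fin m → Finset (Fin p)
  nonem : ∀ i, (J i).Nonempty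
  disj : ∀ i j, i ≠ j → Disjoint (J i) (J j)
  cover : ∀ k : Fin p, ∃ i, k ∈ J i

variable {p m n : ℕ}

/-- The Euclidean norm of the `i`-th block `x_{𝒥ᵢ}` of `x`. -/
def gnorm (G : GroupStructure p m) (x : Fin p → ℝ) (i : Fin m) : ℝ :=
  Real.sqrt (∑ j ∈ G.J i, (x j) ^ 2)

/-- The Euclidean norm of a vector. -/
def enorm' {k : ℕ} (x : Fin k → ℝ) : ℝ := Real.sqrt (∑ j, (x j) ^ 2)

/-- The group support `{i : x_{𝒥ᵢ} ≠ 0}` of `x`. -/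
def gsupp (G : GroupStructure p m) (x : Fin p → ℝ) : Finset (Fin m) :=
  Finset.univ.filter (fun i => ∃ j ∈ G.J i, x j ≠ 0)

/-- The group zero-norm `‖𝒢(x)‖₀` of `x`. -/
def gzero (G : GroupStructure p m) (x : Fin p → ℝ) : ℕ := (gsupp G x).card

/-- `‖𝒢(x)‖_∞`, the largest block norm. -/
def gsup (G : GroupStructure p m) (x : Fin p → ℝ) : ℝ := ⨆ i, gnorm G x i

/-- The box `Ω = {x : ‖x‖_∞ ≤ R}`. -/
def OmegaSet (p : ℕ) (R : ℝ) : Set (Fin p → ℝ) := {x | ∀ j, |x j| ≤ R}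

/-- The least-squares loss `f(x) = (1/(2n))‖Ax - b‖²`. -/
def lsObj (A : Matrix (Fin n) (Fin p) ℝ) (b : Fin n → ℝ) (x : Fin p → ℝ) : ℝ :=
  (1 / (2 * n)) * ∑ i, (A.mulVec x i - b i) ^ 2

/-- The objective of the group zero-norm problem (P). -/
def Pobj (G : GroupStructure p m) (A : Matrix (Fin n) (Fin p) ℝ) (b : Fin n → ℝ)
    (ν : ℝ) (x : Fin p → ℝ) : ℝ :=
  ν * lsObj A b x + (gzero G x : ℝ)

/-- Feasibility for the MPEC (M). -/
def MFeas (G : GroupStructure p m) (R : ℝ) (x : Fin p → ℝ) (w : Fin m → ℝ) : Prop :=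
  x ∈ OmegaSet p R ∧ (∀ i, 0 ≤ w i ∧ w i ≤ 1) ∧ ∑ i, (1 - w i) * gnorm G x i = 0

/-- The objective of the MPEC (M). -/
def Mobj (G : GroupStructure p m) (A : Matrix (Fin n) (Fin p) ℝ) (b : Fin n → ℝ)
    (ν : ℝ) (φ : ℝ → EReal) (x : Fin p → ℝ) (w : Fin m → ℝ) : EReal :=
  ((ν * lsObj A b x : ℝ) : EReal) + ∑ i, φ (w i)

/-- The objective of the penalty problem (Pρ). -/
def PenObj (G : GroupStructure p m) (A : Matrix (Fin n) (Fin p) ℝ) (b : Fin n → ℝ)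
    (ν ρ : ℝ) (φ : ℝ → EReal) (x : Fin p → ℝ) (w : Fin m → ℝ) : EReal :=
  ((ν * lsObj A b x + ρ * ∑ i, (1 - w i) * gnorm G x i : ℝ) : EReal) + ∑ i, φ (w i)

/-- The cone `𝒞(S̄, l)` used in restricted strong convexity. -/
def coneC (G : GroupStructure p m) (tbar : ℝ) (Sb : Finset (Fin m)) (l : ℝ) :
    Set (Fin p → ℝ) :=
  {z | ∃ S : Finset (Fin m), Sb ⊆ S ∧ (S.card : ℝ) ≤ l ∧
    ∑ i ∈ Sᶜ, gnorm G z i ≤ (2 / (1 - tbar)) * ∑ i ∈ S, gnorm G z i}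

/-- `ε̂ = (1/n) Aᵀ ε`. -/
def epsHat (A : Matrix (Fin n) (Fin p) ℝ) (ε : Fin n → ℝ) : Fin p → ℝ :=
  fun j => (1 / (n : ℝ)) * ∑ i, A i j * ε i

/-- The group-wise truncation `x^ρ` of `x` at level `c` (blocks with norm `≤ c` are set to 0). -/
def trunc (G : GroupStructure p m) (c : ℝ) (x : Fin p → ℝ) : Fin p → ℝ :=
  fun j => if ∃ i : Fin m, j ∈ G.J i ∧ c < gnorm G x i then x j else 0

/-- For every `φ ∈ Φ` and every `z ∈ ℝ^m`, `‖z‖₀` is the minimum (attained)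
of `∑ᵢ φ(wᵢ)` over all `w` with `0 ≤ wᵢ ≤ 1` and `‖z‖₁ - ⟨w, |z|⟩ = 0`. -/
theorem zero_norm_variational {m : ℕ} (φ : ℝ → EReal) (tstar : ℝ) (hφ : MemPhi φ tstar)
    (z : Fin m → ℝ) :
    IsLeast {v : EReal | ∃ w : Fin m → ℝ, (∀ i, 0 ≤ w i ∧ w i ≤ 1) ∧
        (∑ i, |z i|) - (∑ i, w i * |z i|) = 0 ∧ v = ∑ i, φ (w i)}
      (((Finset.univ.filter (fun i => z i ≠ 0)).card : ℝ) : EReal) := by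
  have hcard : (((Finset.univ.filter (fun i => z i ≠ 0)).card : ℝ) : EReal)
      = ∑ i, if z i ≠ 0 then (1 : EReal) else 0 := by
    rw [Finset.sum_boole]
    simp
  have hnonneg : ∀ t : ℝ, 0 ≤ t → t ≤ 1 → 0 ≤ φ t := by
    intro t h0 h1
    by_cases ht : t = tstar
    · rw [ht, hφ.phiTstar]
    · exact hφ.phiTstar ▸ (hφ.tstarMin t ⟨h0, h1⟩ ht).le
  rw [hcard]
  constructor
  · refine ⟨fun i => if z i ≠ 0 then 1 else tstar, fun i => ?_, ?_, ?_⟩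
    · dsimp only
      split_ifs
      · exact ⟨zero_le_one, le_rfl⟩
      · exact hφ.tstarMem
    · rw [sub_eq_zero]
      refine Finset.sum_congr rfl fun i _ => ?_
      by_cases h : z i = 0 <;> simp [h]
    · refine Finset.sum_congr rfl fun i _ => ?_
      by_cases h : z i = 0 <;> simp [h, hφ.phiOne, hφ.phiTstar]
  · rintro v ⟨w, hw, hsum, rfl⟩
    have hterm : ∀ i ∈ Finset.univ, (1 - w i) * |z i| = 0 := by
      rw [← Finset.sum_eq_zero_iff_of_nonneg
        fun i _ => mul_nonneg (sub_nonneg.2 (hw i).2) (abs_nonneg _)]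
      simpa [sub_mul, Finset.sum_sub_distrib] using hsum
    refine Finset.sum_le_sum fun i hi => ?_
    split_ifs with h
    · have hwi : w i = 1 := by
        rcases mul_eq_zero.1 (hterm i hi) with h1 | h1
        · linarith
        · exact absurd (abs_eq_zero.1 h1) h
      rw [hwi, hφ.phiOne]
    · exact hnonneg _ (hw i).1 (hw i).2

end
end

section
/- Let φ ∈ Φ. If x* is a global optimal solution of (P), then the pair (x*, w*), where w*_i = 1 if x*_{𝒥_i} ≠ 0 and w*_i = t*_φ otherwise, is a global optimal solution of (M). Conversely, if (x*, w*) is a global optimal solution of (M), then x* is a global optimal solution of (P) and ‖𝒢(x*)‖₀ = Σ_{i=1}^m φ(w*_i). -/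
open scoped BigOperators
open Classical

noncomputable section

variable {p m n : ℕ}

theorem gnorm_nonneg (G : GroupStructure p m) (x : Fin p → ℝ) (i : Fin m) : 0 ≤ gnorm G x i :=
  Real.sqrt_nonneg _

theorem gnorm_eq_zero_iff (G : GroupStructure p m) (x : Fin p → ℝ) (i : Fin m) :
    gnorm G x i = 0 ↔ i ∉ gsupp G x := by
  rw [gnorm, Real.sqrt_eq_zero (Finset.sum_nonneg fun j _ => sq_nonneg _),
    Finset.sum_eq_zero_iff_of_nonneg fun j _ => sq_nonneg _]
  simp [gsupp]

/-- The weight that is `1` on the group support of `x` and `t` elsewhere. -/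
def supportWeight (G : GroupStructure p m) (t : ℝ) (x : Fin p → ℝ) (i : Fin m) : ℝ :=
  if i ∈ gsupp G x then 1 else t

theorem MFeas.supportWeight {G : GroupStructure p m} {R t : ℝ} {x : Fin p → ℝ}
    (hx : x ∈ OmegaSet p R) (ht : t ∈ Set.Icc (0 : ℝ) 1) :
    MFeas G R x (supportWeight G t x) := by
  refine ⟨hx, fun i => ?_, Finset.sum_eq_zero fun i _ => ?_⟩
  · unfold _root_.supportWeight
    split_ifs
    exacts [⟨zero_le_one, le_rfl⟩, ht]
  · unfold _root_.supportWeight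
    split_ifs with h
    · simp
    · rw [(gnorm_eq_zero_iff G x i).2 h, mul_zero]

theorem MFeas.eq_one_of_mem_gsupp {G : GroupStructure p m} {R : ℝ} {x : Fin p → ℝ}
    {w : Fin m → ℝ} (h : MFeas G R x w) {i : Fin m} (hi : i ∈ gsupp G x) : w i = 1 := by
  have hzero := (Finset.sum_eq_zero_iff_of_nonneg fun i _ =>
    mul_nonneg (sub_nonneg.2 (h.2.1 i).2) (gnorm_nonneg G x i)).1 h.2.2 i (Finset.mem_univ i)
  rcases mul_eq_zero.1 hzero with h1 | h1
  · linarith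
  · exact absurd hi ((gnorm_eq_zero_iff G x i).1 h1)

theorem MemPhi.nonneg {φ : ℝ → EReal} {tstar : ℝ} (hφ : MemPhi φ tstar) {t : ℝ}
    (ht : t ∈ Set.Icc (0 : ℝ) 1) : 0 ≤ φ t := by
  rw [← hφ.phiTstar]
  rcases eq_or_ne t tstar with rfl | hne
  exacts [le_rfl, (hφ.tstarMin t ht hne).le]

theorem gzero_eq_sum_ite (G : GroupStructure p m) (x : Fin p → ℝ) :
    ((gzero G x : ℝ) : EReal) = ∑ i, if i ∈ gsupp G x then (1 : EReal) else 0 := by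
  simp [gzero]

theorem sum_phi_supportWeight {φ : ℝ → EReal} {tstar : ℝ} (hφ : MemPhi φ tstar)
    (G : GroupStructure p m) (x : Fin p → ℝ) :
    ∑ i, φ (supportWeight G tstar x i) = ((gzero G x : ℝ) : EReal) := by
  rw [gzero_eq_sum_ite]
  refine Finset.sum_congr rfl fun i _ => ?_
  unfold supportWeight
  split_ifs
  exacts [hφ.phiOne, hφ.phiTstar]

theorem MFeas.gzero_le_sum_phi {G : GroupStructure p m} {R : ℝ} {x : Fin p → ℝ}
    {w : Fin m → ℝ} (h : MFeas G R x w) {φ : ℝ → EReal} {tstar : ℝ} (hφ : MemPhi φ tstar) :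
    ((gzero G x : ℝ) : EReal) ≤ ∑ i, φ (w i) := by
  rw [gzero_eq_sum_ite]
  refine Finset.sum_le_sum fun i _ => ?_
  split_ifs with hi
  · rw [h.eq_one_of_mem_gsupp hi, hφ.phiOne]
  · exact hφ.nonneg (h.2.1 i)

theorem Mobj_supportWeight {φ : ℝ → EReal} {tstar : ℝ} (hφ : MemPhi φ tstar)
    (G : GroupStructure p m) (A : Matrix (Fin n) (Fin p) ℝ) (b : Fin n → ℝ) (ν : ℝ)
    (x : Fin p → ℝ) :
    Mobj G A b ν φ x (supportWeight G tstar x) = (Pobj G A b ν x : EReal) := by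
  rw [Mobj, sum_phi_supportWeight hφ, Pobj, EReal.coe_add]

theorem MFeas.Pobj_le_Mobj {G : GroupStructure p m} {R : ℝ} {x : Fin p → ℝ}
    {w : Fin m → ℝ} (h : MFeas G R x w) {φ : ℝ → EReal} {tstar : ℝ} (hφ : MemPhi φ tstar)
    (A : Matrix (Fin n) (Fin p) ℝ) (b : Fin n → ℝ) (ν : ℝ) :
    (Pobj G A b ν x : EReal) ≤ Mobj G A b ν φ x w := by
  rw [Mobj, Pobj, EReal.coe_add]
  exact add_le_add le_rfl (h.gzero_le_sum_phi hφ)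

/-- Global solutions of the group zero-norm problem (P) correspond to global
solutions of its MPEC reformulation (M): if `x*` solves (P) then `(x*, w*)` with `w*ᵢ = 1` on
the group support of `x*` and `w*ᵢ = tstar` elsewhere solves (M); conversely if `(x*, w*)`
solves (M) then `x*` solves (P) and `‖𝒢(x*)‖₀ = ∑ᵢ φ(w*ᵢ)`. -/
theorem P_MPEC_equiv {p m n : ℕ} (G : GroupStructure p m) (A : Matrix (Fin n) (Fin p) ℝ)
    (b : Fin n → ℝ) (ν R : ℝ) (hν : 0 < ν) (hR : 0 < R)
    (φ : ℝ → EReal) (tstar : ℝ) (hφ : MemPhi φ tstar) :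
    (∀ xs : Fin p → ℝ, xs ∈ OmegaSet p R →
      (∀ y ∈ OmegaSet p R, Pobj G A b ν xs ≤ Pobj G A b ν y) →
      (MFeas G R xs (fun i => if i ∈ gsupp G xs then 1 else tstar) ∧
        ∀ y w, MFeas G R y w →
          Mobj G A b ν φ xs (fun i => if i ∈ gsupp G xs then 1 else tstar) ≤
            Mobj G A b ν φ y w))
    ∧
    (∀ xs ws, MFeas G R xs ws →
      (∀ y w, MFeas G R y w → Mobj G A b ν φ xs ws ≤ Mobj G A b ν φ y w) →
      ((∀ y ∈ OmegaSet p R, Pobj G A b ν xs ≤ Pobj G A b ν y) ∧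
        ((gzero G xs : ℝ) : EReal) = ∑ i, φ (ws i))) := by
  refine ⟨fun xs hxs hopt => ⟨MFeas.supportWeight hxs hφ.tstarMem, fun y w hyw => ?_⟩,
    fun xs ws hfeas hopt => ⟨fun y hy => ?_, ?_⟩⟩
  · calc Mobj G A b ν φ xs (supportWeight G tstar xs)
        = (Pobj G A b ν xs : EReal) := Mobj_supportWeight hφ G A b ν xs
      _ ≤ (Pobj G A b ν y : EReal) := EReal.coe_le_coe_iff.2 (hopt y hyw.1)
      _ ≤ Mobj G A b ν φ y w := hyw.Pobj_le_Mobj hφ A b ν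
  · rw [← EReal.coe_le_coe_iff, ← Mobj_supportWeight hφ G A b ν y]
    exact (hfeas.Pobj_le_Mobj hφ A b ν).trans
      (hopt y _ (MFeas.supportWeight hy hφ.tstarMem))
  · refine le_antisymm (hfeas.gzero_le_sum_phi hφ) ?_
    have hle := hopt xs _ (MFeas.supportWeight hfeas.1 hφ.tstarMem)
    rw [Mobj, Mobj, sum_phi_supportWeight hφ] at hle
    exact EReal.addLECancellable_coe _ hle

end
end

section
/- Let φ ∈ Φ, let ω ≥ 0, and define v* := min_{t∈[0,1]} { φ(t) + ω(1−t) }. Then: (i) v* = 1 if ω > φ'₋(1); (ii) v* ≥ ω(1−t̄_φ) / (φ'₋(1)(1−t*_φ)) if 1/(1−t*_φ) ≤ ω ≤ φ'₋(1); (iii) v* ≥ ω(1−t̄_φ) if 0 ≤ ω < 1/(1−t*_φ). -/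
open scoped BigOperators
open Classical

noncomputable section

variable {p m n : ℕ}

/-- Slope comparison across an interior point for a convex extended-real-valued function. -/
theorem ERealConvexOn.slope_le_slope {φ : ℝ → EReal} (hφ : ERealConvexOn φ) {s x u a b c : ℝ}
    (hs : φ s = a) (hx : φ x = b) (hu : φ u = c) (hsx : s < x) (hxu : x < u) :
    (b - a) / (x - s) ≤ (c - b) / (u - x) := by
  have hsu : 0 < u - s := by linarith
  have h := hφ s u ((u - x) / (u - s)) (div_nonneg (by linarith) hsu.le)
    ((div_le_one hsu).2 (by linarith))
  have hpt : (u - x) / (u - s) * s + (1 - (u - x) / (u - s)) * u = x := by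
    field_simp
    ring
  rw [hpt, hs, hx, hu] at h
  have h' : b ≤ (u - x) / (u - s) * a + (1 - (u - x) / (u - s)) * c := by exact_mod_cast h
  have e : (u - x) / (u - s) * a + (1 - (u - x) / (u - s)) * c
      = ((u - x) * a + (x - s) * c) / (u - s) := by
    field_simp
    ring
  rw [e, le_div_iff₀ hsu] at h'
  rw [div_le_div_iff₀ (by linarith) (by linarith)]
  linarith

/-- A proper convex function has a subgradient at every point of the interior of its domain. -/
theorem ERealConvexOn.subdiff_nonempty {φ : ℝ → EReal} (hφ : ERealConvexOn φ)
    (hbot : ∀ t, φ t ≠ ⊥) {x : ℝ} (hx : x ∈ interior {t | φ t ≠ ⊤}) : (subdiff φ x).Nonempty := by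
  obtain ⟨ε, hε, hball⟩ := Metric.mem_nhds_iff.1 (mem_interior_iff_mem_nhds.1 hx)
  have hfin : ∀ t, φ t ≠ ⊤ → φ t = ((φ t).toReal : EReal) := fun t ht =>
    (EReal.coe_toReal ht (hbot t)).symm
  have hdom : ∀ t, |t - x| < ε → φ t ≠ ⊤ := fun t ht => hball (by simpa [Real.dist_eq] using ht)
  have h_top : φ x ≠ ⊤ := hdom x (by simpa using hε)
  have hr : φ (x + ε / 2) ≠ ⊤ := hdom _ (by rw [add_sub_cancel_left, abs_of_pos] <;> linarith)
  have hl : φ (x - ε / 2) ≠ ⊤ := hdom _ (by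
    rw [sub_sub_cancel_left, abs_neg, abs_of_pos] <;> linarith)
  let S : Set ℝ := (fun s => ((φ x).toReal - (φ s).toReal) / (x - s)) '' {s | s < x ∧ φ s ≠ ⊤}
  have hne : S.Nonempty := ⟨_, x - ε / 2, ⟨by linarith, hl⟩, rfl⟩
  have hub : ∀ u, x < u → φ u ≠ ⊤ → ((φ u).toReal - (φ x).toReal) / (u - x) ∈ upperBounds S := by
    rintro u hxu hu _ ⟨s, ⟨hsx, hs⟩, rfl⟩
    exact hφ.slope_le_slope (hfin s hs) (hfin x h_top) (hfin u hu) hsx hxu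
  refine ⟨sSup S, fun s => ?_⟩
  by_cases hs : φ s = ⊤
  · simp [hs]
  rw [hfin s hs, hfin x h_top, ← EReal.coe_add, EReal.coe_le_coe_iff]
  rcases lt_trichotomy s x with hsx | rfl | hxs
  · have h := le_csSup ⟨_, hub _ (by linarith) hr⟩
      (show _ ∈ S from ⟨s, ⟨hsx, hs⟩, rfl⟩)
    rw [div_le_iff₀ (by linarith)] at h
    linarith
  · simp
  · have h := csSup_le hne (hub s hxs hs)
    rw [le_div_iff₀ (by linarith)] at h
    linarith

/-- A subgradient `c` at `r` of a function nonnegative on `[0,1]` bounds the penalized function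
from below for every penalty parameter not exceeding `c`. -/
theorem mul_one_sub_le_penalty {φ : ℝ → EReal} {r c w : ℝ}
    (hpos : ∀ t ∈ Set.Icc (0:ℝ) 1, 0 ≤ φ t) (hr : r ∈ Set.Icc (0:ℝ) 1) (hc : c ∈ subdiff φ r)
    (hw : 0 ≤ w) (hwc : w ≤ c) {t : ℝ} (ht : t ∈ Set.Icc (0:ℝ) 1) :
    ((w * (1 - r) : ℝ) : EReal) ≤ φ t + ((w * (1 - t) : ℝ) : EReal) := by
  have key : ((w * (t - r) : ℝ) : EReal) ≤ φ t := by
    rcases le_total r t with h | h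
    · calc ((w * (t - r) : ℝ) : EReal) ≤ ((c * (t - r) : ℝ) : EReal) :=
            EReal.coe_le_coe_iff.2 (mul_le_mul_of_nonneg_right hwc (by linarith))
        _ = 0 + ((c * (t - r) : ℝ) : EReal) := (zero_add _).symm
        _ ≤ φ r + ((c * (t - r) : ℝ) : EReal) := by gcongr; exact hpos r hr
        _ ≤ φ t := hc t
    · refine le_trans ?_ (hpos t ht)
      exact_mod_cast mul_nonpos_of_nonneg_of_nonpos hw (by linarith)
  calc ((w * (1 - r) : ℝ) : EReal)
      = ((w * (t - r) : ℝ) : EReal) + ((w * (1 - t) : ℝ) : EReal) := by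
        rw [← EReal.coe_add]; congr 1; ring
    _ ≤ _ := by gcongr

/-- **Lemma B.2.** For `φ ∈ Φ` and `ω ≥ 0`, with
`v* = min_{t ∈ [0,1]} (φ(t) + ω(1-t))`: (i) `v* = 1` if `ω > φ'₋(1)`;
(ii) `v* ≥ ω(1-tbar)/(φ'₋(1)(1-tstar))` if `1/(1-tstar) ≤ ω ≤ φ'₋(1)`;
(iii) `v* ≥ ω(1-tbar)` if `0 ≤ ω < 1/(1-tstar)`. -/
theorem min_phi_penalty_bounds (φ : ℝ → EReal) (tstar tbar : ℝ) (hφ : MemPhi φ tstar)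
    (htbar : IsTbar φ tstar tbar) (ω : ℝ) (hω : 0 ≤ ω) :
    (leftDeriv φ 1 < ω →
      sInf ((fun t => φ t + ((ω * (1 - t) : ℝ) : EReal)) '' Set.Icc (0:ℝ) 1) = 1)
    ∧ (1 / (1 - tstar) ≤ ω → ω ≤ leftDeriv φ 1 →
      ((ω * (1 - tbar) / (leftDeriv φ 1 * (1 - tstar)) : ℝ) : EReal) ≤
        sInf ((fun t => φ t + ((ω * (1 - t) : ℝ) : EReal)) '' Set.Icc (0:ℝ) 1))
    ∧ (ω < 1 / (1 - tstar) →
      ((ω * (1 - tbar) : ℝ) : EReal) ≤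
        sInf ((fun t => φ t + ((ω * (1 - t) : ℝ) : EReal)) '' Set.Icc (0:ℝ) 1)) := by
  have hpos : ∀ t ∈ Set.Icc (0:ℝ) 1, 0 ≤ φ t := fun t ht => by
    rw [← hφ.phiTstar]
    rcases eq_or_ne t tstar with rfl | h
    · exact le_rfl
    · exact (hφ.tstarMin t ht h).le
  obtain ⟨⟨h1, h2⟩, hc, -⟩ := htbar
  have hr : tbar ∈ Set.Icc (0:ℝ) 1 := ⟨hφ.tstarMem.1.trans h1, h2.le⟩
  have hd : 0 < 1 - tstar := by linarith
  have hcpos : 0 < 1 / (1 - tstar) := by positivity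
  refine ⟨fun h => ?_, fun h3 h4 => ?_, fun h => ?_⟩
  · obtain ⟨g, hg, hgω⟩ := exists_lt_of_csInf_lt
      (hφ.convex.subdiff_nonempty hφ.proper (hφ.domInt (Set.right_mem_Icc.2 zero_le_one))) h
    apply le_antisymm
    · refine sInf_le ⟨1, Set.right_mem_Icc.2 zero_le_one, ?_⟩
      simp [hφ.phiOne]
    · refine le_sInf ?_
      rintro _ ⟨t, ht, rfl⟩
      have hgt := hg t
      rw [hφ.phiOne] at hgt
      calc (1 : EReal) ≤ 1 + ((g * (t - 1) : ℝ) : EReal) + ((ω * (1 - t) : ℝ) : EReal) := by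
            have : 1 ≤ 1 + g * (t - 1) + ω * (1 - t) := by nlinarith [ht.2]
            exact_mod_cast this
        _ ≤ _ := add_le_add hgt le_rfl
  · refine le_sInf ?_
    rintro _ ⟨t, ht, rfl⟩
    have hL : 0 < leftDeriv φ 1 := by linarith
    calc ((ω * (1 - tbar) / (leftDeriv φ 1 * (1 - tstar)) : ℝ) : EReal)
        ≤ ((1 / (1 - tstar) * (1 - tbar) : ℝ) : EReal) := by
          rw [EReal.coe_le_coe_iff, one_div_mul_eq_div, div_le_div_iff₀ (by positivity) hd]
          nlinarith [mul_le_mul_of_nonneg_right h4 (mul_pos (sub_pos.2 h2) hd).le]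
      _ ≤ φ t + ((1 / (1 - tstar) * (1 - t) : ℝ) : EReal) :=
          mul_one_sub_le_penalty hpos hr hc hcpos.le le_rfl ht
      _ ≤ _ := by
          refine add_le_add le_rfl (EReal.coe_le_coe_iff.2 ?_)
          exact mul_le_mul_of_nonneg_right h3 (by linarith [ht.2])
  · refine le_sInf ?_
    rintro _ ⟨t, ht, rfl⟩
    exact mul_one_sub_le_penalty hpos hr hc hω h.le ht

end
end

section
/- Let φ ∈ Φ. For x ∈ Ω and ρ > 0, define the truncated vector x^ρ ∈ Ω blockwise by (x^ρ)_{𝒥_i} = x_{𝒥_i} if ‖x_{𝒥_i}‖ > φ'₋(1)/ρ and (x^ρ)_{𝒥_i} = 0 otherwise. Then for every x ∈ Ω, every w ∈ ℝ^m with 0 ≤ w ≤ e, and every ρ > ρ̄ := ν L_f (1−t*_φ) φ'₋(1) / (1−t̄_φ), one has ν f(x^ρ) + ‖𝒢(x^ρ)‖₀ ≤ ν f(x) + Σ_{i=1}^m [ φ(w_i) + ρ(1−w_i)‖x_{𝒥_i}‖ ]; moreover, if this inequality holds with equality, then x^ρ = x and ‖𝒢(x)‖₁ − ⟨w, 𝒢(x)⟩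 = 0. -/
open scoped BigOperators
open Classical

noncomputable section

variable {p m n : ℕ}

/-- An extended-real convex function that is finite around `a` and at some point left of `a`
has a subgradient at `a`. -/
theorem subdiff_nonempty_of_mem_interior {φ : ℝ → EReal} (hconv : ERealConvexOn φ)
    (hbot : ∀ t, φ t ≠ ⊥) {a : ℝ} (ha : a ∈ interior {t | φ t ≠ ⊤}) :
    (subdiff φ a).Nonempty := by
  obtain ⟨ε, hε, hball⟩ := Metric.isOpen_iff.1 isOpen_interior a ha
  have hfin : ∀ t, |t - a| < ε → φ t ≠ ⊤ := fun t ht =>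
    interior_subset (hball (by rwa [Metric.mem_ball, Real.dist_eq]))
  have hcoe : ∀ t, φ t ≠ ⊤ → φ t = ((φ t).toReal : EReal) := fun t ht =>
    (EReal.coe_toReal ht (hbot t)).symm
  have hatop : φ a ≠ ⊤ := hfin a (by simpa using hε)
  have three : ∀ s r, s < a → a < r → φ s ≠ ⊤ → φ r ≠ ⊤ →
      ((φ s).toReal - (φ a).toReal) / (s - a) ≤ ((φ r).toReal - (φ a).toReal) / (r - a) := by
    intro s r hs hr hst hrt
    have hrs : 0 < r - s := by linarith
    have h := hconv s r ((r - a) / (r - s)) (div_nonneg (by linarith) hrs.le)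
      ((div_le_one hrs).2 (by linarith))
    have hcomb : (r - a) / (r - s) * s + (1 - (r - a) / (r - s)) * r = a := by
      field_simp
      ring
    rw [hcomb, hcoe s hst, hcoe r hrt, hcoe a hatop] at h
    have h' : (φ a).toReal ≤ (r - a) / (r - s) * (φ s).toReal
        + (1 - (r - a) / (r - s)) * (φ r).toReal := by exact_mod_cast h
    have hmul := mul_le_mul_of_nonneg_left h' hrs.le
    have hexp : (r - s) * ((r - a) / (r - s) * (φ s).toReal
        + (1 - (r - a) / (r - s)) * (φ r).toReal)
        = (r - a) * (φ s).toReal + (a - s) * (φ r).toReal := by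
      field_simp
      ring
    rw [hexp] at hmul
    rw [← neg_div_neg_eq, div_le_div_iff₀ (by linarith) (by linarith)]
    linarith
  set S : Set ℝ := {q | ∃ r, a < r ∧ φ r ≠ ⊤ ∧ q = ((φ r).toReal - (φ a).toReal) / (r - a)}
  have hSne : S.Nonempty :=
    ⟨_, a + ε / 2, by linarith, hfin _ (by
      rw [add_sub_cancel_left, abs_of_pos (by linarith)]
      linarith), rfl⟩
  have hlow : ∀ s, s < a → φ s ≠ ⊤ →
      ((φ s).toReal - (φ a).toReal) / (s - a) ∈ lowerBounds S := by
    rintro s hs hst q ⟨r, hr, hrt, rfl⟩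
    exact three s r hs hr hst hrt
  have hbdd : BddBelow S :=
    ⟨_, hlow (a - ε / 2) (by linarith) (hfin _ (by
      rw [sub_sub_cancel_left, abs_neg, abs_of_pos (by linarith)]
      linarith))⟩
  refine ⟨sInf S, fun s => ?_⟩
  by_cases hst : φ s = ⊤
  · rw [hst]
    exact le_top
  rw [hcoe a hatop, hcoe s hst]
  suffices (φ a).toReal + sInf S * (s - a) ≤ (φ s).toReal by exact_mod_cast this
  rcases lt_trichotomy s a with hs | rfl | hs
  · have h := le_csInf hSne (hlow s hs hst)
    rw [div_le_iff_of_neg (by linarith)] at h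
    linarith
  · simp
  · have h := csInf_le hbdd ⟨s, hs, hst, rfl⟩
    rw [le_div_iff₀ (by linarith)] at h
    linarith

theorem MemPhi.coe_toReal {φ : ℝ → EReal} {tstar t : ℝ} (hφ : MemPhi φ tstar)
    (ht : t ∈ Set.Icc (0 : ℝ) 1) : φ t = ((φ t).toReal : EReal) :=
  (EReal.coe_toReal (interior_subset (hφ.domInt ht)) (hφ.proper t)).symm

theorem MemPhi.toReal_nonneg {φ : ℝ → EReal} {tstar t : ℝ} (hφ : MemPhi φ tstar)
    (ht : t ∈ Set.Icc (0 : ℝ) 1) : 0 ≤ (φ t).toReal := by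
  apply EReal.toReal_nonneg
  rw [← hφ.phiTstar]
  by_cases h : t = tstar
  · rw [h]
  · exact (hφ.tstarMin t ht h).le

theorem MemPhi.tstar_lt_one {φ : ℝ → EReal} {tstar : ℝ} (hφ : MemPhi φ tstar) : tstar < 1 := by
  refine lt_of_le_of_ne hφ.tstarMem.2 ?_
  rintro rfl
  exact one_ne_zero (hφ.phiOne.symm.trans hφ.phiTstar)

theorem MemPhi.one_sub_le_of_mem_subdiff {φ : ℝ → EReal} {tstar t g : ℝ} (hφ : MemPhi φ tstar)
    (ht : t ∈ Set.Icc (0 : ℝ) 1) (hg : g ∈ subdiff φ 1) :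
    1 - (φ t).toReal ≤ g * (1 - t) := by
  have h := hg t
  rw [hφ.phiOne, hφ.coe_toReal ht] at h
  have h' : 1 + g * (t - 1) ≤ (φ t).toReal := by exact_mod_cast h
  linarith

theorem MemPhi.subdiff_one_nonempty {φ : ℝ → EReal} {tstar : ℝ} (hφ : MemPhi φ tstar) :
    (subdiff φ 1).Nonempty :=
  subdiff_nonempty_of_mem_interior hφ.convex hφ.proper (hφ.domInt (by simp))

theorem MemPhi.one_sub_le_leftDeriv_mul {φ : ℝ → EReal} {tstar t : ℝ} (hφ : MemPhi φ tstar)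
    (ht : t ∈ Set.Icc (0 : ℝ) 1) : 1 - (φ t).toReal ≤ leftDeriv φ 1 * (1 - t) := by
  rcases ht.2.eq_or_lt with rfl | h1
  · simp [hφ.phiOne]
  · rw [← div_le_iff₀ (by linarith)]
    refine le_csInf hφ.subdiff_one_nonempty fun g hg => ?_
    rw [div_le_iff₀ (by linarith)]
    exact hφ.one_sub_le_of_mem_subdiff ht hg

theorem MemPhi.leftDeriv_one_pos {φ : ℝ → EReal} {tstar : ℝ} (hφ : MemPhi φ tstar) :
    0 < leftDeriv φ 1 := by
  have h := hφ.one_sub_le_leftDeriv_mul hφ.tstarMem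
  rw [hφ.phiTstar, EReal.toReal_zero, sub_zero] at h
  exact pos_of_mul_pos_left (zero_lt_one.trans_le h) (sub_nonneg.2 hφ.tstarMem.2)

theorem eq_zero_of_gnorm_eq_zero {G : GroupStructure p m} {x : Fin p → ℝ} {i : Fin m}
    (h : gnorm G x i = 0) {j : Fin p} (hj : j ∈ G.J i) : x j = 0 := by
  have hsum := (Real.sqrt_eq_zero (Finset.sum_nonneg fun j _ => sq_nonneg (x j))).1 h
  exact pow_eq_zero_iff two_ne_zero |>.1
    ((Finset.sum_eq_zero_iff_of_nonneg fun j _ => sq_nonneg (x j)).1 hsum j hj)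

theorem enorm'_le_sum_gnorm (G : GroupStructure p m) (x : Fin p → ℝ) :
    enorm' x ≤ ∑ i, gnorm G x i := by
  refine Real.sqrt_le_iff.2 ⟨Finset.sum_nonneg fun i _ => gnorm_nonneg G x i, ?_⟩
  have hcov : (Finset.univ : Finset (Fin p)) = Finset.univ.biUnion G.J := by
    ext k
    simpa using G.cover k
  calc ∑ j, x j ^ 2 = ∑ i, ∑ j ∈ G.J i, x j ^ 2 := by
        rw [hcov, Finset.sum_biUnion fun i _ j _ hij => G.disj i j hij]
    _ = ∑ i, gnorm G x i ^ 2 := Finset.sum_congr rfl fun i _ =>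
        (Real.sq_sqrt (Finset.sum_nonneg fun j _ => sq_nonneg (x j))).symm
    _ ≤ (∑ i, gnorm G x i) ^ 2 :=
        Finset.sum_sq_le_sq_sum_of_nonneg fun i _ => gnorm_nonneg G x i

theorem trunc_apply_of_mem {G : GroupStructure p m} {c : ℝ} {x : Fin p → ℝ} {i : Fin m}
    {j : Fin p} (hj : j ∈ G.J i) : trunc G c x j = if c < gnorm G x i then x j else 0 := by
  refine if_congr ⟨?_, fun h => ⟨i, hj, h⟩⟩ rfl rfl
  rintro ⟨k, hk, h⟩
  have hki : k = i := by
    by_contra hne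
    exact Finset.disjoint_left.1 (G.disj k i hne) hk hj
  rwa [← hki]

theorem trunc_mem_OmegaSet {G : GroupStructure p m} {c R : ℝ} {x : Fin p → ℝ}
    (hx : x ∈ OmegaSet p R) : trunc G c x ∈ OmegaSet p R := by
  intro j
  unfold trunc
  split_ifs
  · exact hx j
  · simpa using (abs_nonneg _).trans (hx j)

theorem gnorm_trunc_sub (G : GroupStructure p m) (c : ℝ) (x : Fin p → ℝ) (i : Fin m) :
    gnorm G (trunc G c x - x) i = if c < gnorm G x i then 0 else gnorm G x i := by
  have hsum : ∑ j ∈ G.J i, (trunc G c x - x) j ^ 2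
      = ∑ j ∈ G.J i, (if c < gnorm G x i then 0 else x j ^ 2) := by
    refine Finset.sum_congr rfl fun j hj => ?_
    rw [Pi.sub_apply, trunc_apply_of_mem hj]
    split_ifs <;> simp
  rw [gnorm, hsum]
  split_ifs
  · simp
  · rfl

theorem gzero_trunc_le (G : GroupStructure p m) (c : ℝ) (x : Fin p → ℝ) :
    (gzero G (trunc G c x) : ℝ) ≤ ∑ i, if c < gnorm G x i then 1 else 0 := by
  rw [Finset.sum_boole]
  refine Nat.cast_le.2 (Finset.card_le_card fun i hi => ?_)
  obtain ⟨j, hj, hne⟩ := (Finset.mem_filter.1 hi).2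
  rw [trunc_apply_of_mem hj] at hne
  refine Finset.mem_filter.2 ⟨Finset.mem_univ i, ?_⟩
  by_contra h
  exact hne (if_neg h)

theorem trunc_eq_self {G : GroupStructure p m} {c : ℝ} {x : Fin p → ℝ}
    (h : ∀ i, c < gnorm G x i ∨ gnorm G x i = 0) : trunc G c x = x := by
  funext j
  obtain ⟨i, hj⟩ := G.cover j
  rw [trunc_apply_of_mem hj]
  rcases h i with hi | hi
  · exact if_pos hi
  · rw [eq_zero_of_gnorm_eq_zero hi hj, ite_self]

theorem MemPhi.blockBound_le {φ : ℝ → EReal} {tstar : ℝ} (hφ : MemPhi φ tstar) {K ρ a t : ℝ}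
    (hρ : 0 < ρ) (hK : K * leftDeriv φ 1 < ρ) (ha : 0 ≤ a) (ht : t ∈ Set.Icc (0 : ℝ) 1) :
    (if leftDeriv φ 1 / ρ < a then 1 else K * a) ≤ (φ t).toReal + ρ * (1 - t) * a ∧
    ((if leftDeriv φ 1 / ρ < a then 1 else K * a) = (φ t).toReal + ρ * (1 - t) * a →
      (leftDeriv φ 1 / ρ < a ∧ t = 1) ∨ a = 0) := by
  have hd := hφ.leftDeriv_one_pos
  have h1 := hφ.one_sub_le_leftDeriv_mul ht
  have h0 := hφ.toReal_nonneg ht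
  generalize (φ t).toReal = v at *
  generalize leftDeriv φ 1 = d at *
  split_ifs with hc
  · rw [div_lt_iff₀ hρ] at hc
    refine ⟨by nlinarith [mul_nonneg (sub_nonneg.2 ht.2) (sub_nonneg.2 hc.le)],
      fun h => Or.inl ⟨(div_lt_iff₀ hρ).2 hc, ?_⟩⟩
    by_contra hne
    have ht1 : 0 < 1 - t := sub_pos.2 (lt_of_le_of_ne ht.2 hne)
    nlinarith [mul_pos ht1 (sub_pos.2 hc)]
  · rw [div_lt_iff₀ hρ, not_lt] at hc
    have hinterp : ρ * a ≤ d * (v + ρ * (1 - t) * a) := by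
      nlinarith [mul_nonneg h0 (sub_nonneg.2 hc),
        mul_nonneg (mul_nonneg hρ.le ha) (sub_nonneg.2 h1)]
    refine ⟨?_, fun h => Or.inr ?_⟩
    · refine le_of_mul_le_mul_left ?_ hd
      nlinarith [mul_nonneg ha (sub_nonneg.2 hK.le)]
    · by_contra hne
      have ha' : 0 < a := lt_of_le_of_ne ha (Ne.symm hne)
      rw [← h] at hinterp
      nlinarith [mul_pos ha' (sub_pos.2 hK)]

theorem lipschitz_const_nonneg_of_OmegaSet {R K : ℝ} (hp : 0 < p) (hR : 0 < R)
    {f : (Fin p → ℝ) → ℝ}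
    (hK : ∀ x ∈ OmegaSet p R, ∀ y ∈ OmegaSet p R, |f x - f y| ≤ K * enorm' (x - y)) :
    0 ≤ K := by
  have h := hK (fun _ => R) (fun _ => (abs_of_pos hR).le) 0 (fun _ => by simpa using hR.le)
  refine nonneg_of_mul_nonneg_left ((abs_nonneg _).trans h) (Real.sqrt_pos.2 ?_)
  have : Nonempty (Fin p) := ⟨⟨0, hp⟩⟩
  exact Finset.sum_pos (fun _ _ => by simpa using pow_pos hR 2) Finset.univ_nonempty

/-- **Lemma B.3.** For every `x ∈ Ω`, `0 ≤ w ≤ e` and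
`ρ > ρ̄ = ν L_f (1-tstar) φ'₋(1)/(1-tbar)`, the truncation `x^ρ` satisfies
`ν f(x^ρ) + ‖𝒢(x^ρ)‖₀ ≤ ν f(x) + ∑ᵢ [φ(wᵢ) + ρ(1-wᵢ)‖x_{𝒥ᵢ}‖]`; and if equality holds then
`x^ρ = x` and `‖𝒢(x)‖₁ - ⟨w, 𝒢(x)⟩ = 0`. -/
theorem bound_penalty {p m n : ℕ} (G : GroupStructure p m) (A : Matrix (Fin n) (Fin p) ℝ)
    (b : Fin n → ℝ) (ν R Lf : ℝ) (hν : 0 < ν) (hR : 0 < R)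
    (hLf : ∀ x ∈ OmegaSet p R, ∀ y ∈ OmegaSet p R,
      |lsObj A b x - lsObj A b y| ≤ Lf * enorm' (x - y))
    (φ : ℝ → EReal) (tstar tbar : ℝ) (hφ : MemPhi φ tstar) (htbar : IsTbar φ tstar tbar)
    (x : Fin p → ℝ) (hx : x ∈ OmegaSet p R) (w : Fin m → ℝ) (hw : ∀ i, 0 ≤ w i ∧ w i ≤ 1)
    (ρ : ℝ) (hρ : ν * Lf * ((1 - tstar) * leftDeriv φ 1) / (1 - tbar) < ρ) :
    (((ν * lsObj A b (trunc G (leftDeriv φ 1 / ρ) x) +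
          (gzero G (trunc G (leftDeriv φ 1 / ρ) x) : ℝ) : ℝ)) : EReal) ≤
      ((ν * lsObj A b x : ℝ) : EReal) +
        ∑ i, (φ (w i) + ((ρ * (1 - w i) * gnorm G x i : ℝ) : EReal))
    ∧ ((((ν * lsObj A b (trunc G (leftDeriv φ 1 / ρ) x) +
          (gzero G (trunc G (leftDeriv φ 1 / ρ) x) : ℝ) : ℝ)) : EReal) =
        ((ν * lsObj A b x : ℝ) : EReal) +
          ∑ i, (φ (w i) + ((ρ * (1 - w i) * gnorm G x i : ℝ) : EReal)) →
        trunc G (leftDeriv φ 1 / ρ) x = x ∧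
          (∑ i, gnorm G x i) - ∑ i, w i * gnorm G x i = 0) := by
  have hcoe : ((ν * lsObj A b x : ℝ) : EReal) +
        ∑ i, (φ (w i) + ((ρ * (1 - w i) * gnorm G x i : ℝ) : EReal)) =
      ((ν * lsObj A b x + ∑ i, ((φ (w i)).toReal + ρ * (1 - w i) * gnorm G x i) : ℝ) :
        EReal) := by
    have hsum : ∀ s : Finset (Fin m),
        ∑ i ∈ s, (φ (w i) + ((ρ * (1 - w i) * gnorm G x i : ℝ) : EReal)) =
        ((∑ i ∈ s, ((φ (w i)).toReal + ρ * (1 - w i) * gnorm G x i) : ℝ) : EReal) := by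
      intro s
      induction s using Finset.induction_on with
      | empty => simp
      | insert i s hi ih =>
        rw [Finset.sum_insert hi, Finset.sum_insert hi, ih, EReal.coe_add, EReal.coe_add,
          ← hφ.coe_toReal (hw i)]
    rw [hsum, ← EReal.coe_add]
  rw [hcoe, EReal.coe_le_coe_iff, EReal.coe_eq_coe_iff]
  rcases Nat.eq_zero_or_pos p with rfl | hp
  · have hm : IsEmpty (Fin m) := ⟨fun i => (G.nonem i).choose.elim0⟩
    have hx' : trunc G (leftDeriv φ 1 / ρ) x = x := Subsingleton.elim _ _
    have hz : gzero G x = 0 := by simp [gzero, gsupp]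
    rw [hx', hz]
    simp
  have hLf0 : 0 ≤ Lf := lipschitz_const_nonneg_of_OmegaSet hp hR hLf
  have hd := hφ.leftDeriv_one_pos
  have hK : ν * Lf * leftDeriv φ 1 < ρ := by
    refine lt_of_le_of_lt ?_ hρ
    rw [le_div_iff₀ (by linarith [htbar.1.2])]
    exact (mul_le_mul_of_nonneg_left (sub_le_sub_left htbar.1.1 1)
      (mul_nonneg (mul_nonneg hν.le hLf0) hd.le)).trans_eq (by ring)
  have hρ0 : 0 < ρ := lt_of_le_of_lt (mul_nonneg (mul_nonneg hν.le hLf0) hd.le) hK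
  have hblock := fun i => hφ.blockBound_le hρ0 hK (gnorm_nonneg G x i) (hw i)
  have hz := gzero_trunc_le G (leftDeriv φ 1 / ρ) x
  have hf : ν * lsObj A b (trunc G (leftDeriv φ 1 / ρ) x) - ν * lsObj A b x ≤
      ∑ i, if leftDeriv φ 1 / ρ < gnorm G x i then 0 else ν * Lf * gnorm G x i := by
    calc ν * lsObj A b (trunc G (leftDeriv φ 1 / ρ) x) - ν * lsObj A b x
        ≤ ν * (Lf * enorm' (trunc G (leftDeriv φ 1 / ρ) x - x)) := by
          rw [← mul_sub]
          exact mul_le_mul_of_nonneg_left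
            ((le_abs_self _).trans (hLf _ (trunc_mem_OmegaSet hx) _ hx)) hν.le
      _ ≤ ν * Lf * ∑ i, gnorm G (trunc G (leftDeriv φ 1 / ρ) x - x) i := by
          rw [← mul_assoc]
          exact mul_le_mul_of_nonneg_left (enorm'_le_sum_gnorm G _) (mul_nonneg hν.le hLf0)
      _ = _ := by simp only [gnorm_trunc_sub, Finset.mul_sum, mul_ite, mul_zero]
  have hsplit : ∑ i, (if leftDeriv φ 1 / ρ < gnorm G x i then 1 else ν * Lf * gnorm G x i) =
      (∑ i, if leftDeriv φ 1 / ρ < gnorm G x i then 0 else ν * Lf * gnorm G x i) +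
      ∑ i, if leftDeriv φ 1 / ρ < gnorm G x i then 1 else 0 := by
    rw [← Finset.sum_add_distrib]
    refine Finset.sum_congr rfl fun i _ => ?_
    split_ifs <;> simp
  have hle := Finset.sum_le_sum fun i (_ : i ∈ Finset.univ) => (hblock i).1
  refine ⟨by linarith, fun heq => ?_⟩
  have hall := (Finset.sum_eq_sum_iff_of_le fun i _ => (hblock i).1).1
    (le_antisymm hle (by linarith))
  have hcase := fun i => (hblock i).2 (hall i (Finset.mem_univ i))
  refine ⟨trunc_eq_self fun i => (hcase i).imp_left And.left, ?_⟩
  rw [← Finset.sum_sub_distrib]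
  refine Finset.sum_eq_zero fun i _ => ?_
  rcases hcase i with ⟨-, hi⟩ | hi <;> simp [hi]

end
end

section
/- Consider the GEP-MSCRA iterates (x^k, w^k). Suppose x̄ ∈ Ω, A satisfies the RSC of constant κ > 0 over 𝒞(S̄, 1.5r̄), √3(4−2t̄_φ)(1−t*_φ)/((3−t̄_φ)κ) ≤ ν ≤ (1−t̄_φ)/((3−t̄_φ)‖𝒢(ε̂)‖_∞), and ν(3−t̄_φ)‖𝒢(ε̂)‖_∞/(1−t̄_φ) ≤ ρ ≤ √((3−t̄_φ)κν/(√3(4−2t̄_φ)(1−t*_φ))). Then ‖x¹ − x̄‖ ≤ (ν^{-1}(4−2t̄_φ)/(κ(3−t̄_φ)))·√(1.5 r̄), and for every k ≥ 2, ‖x^k − x̄‖ ≤ (ρ ν^{-1}(4−2t̄_φ)/(κ(3−t̄_φ)))·√(1.5 r̄). -/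
open scoped BigOperators
open Classical

noncomputable section

variable {p m n : ℕ}

theorem gnorm_eq_norm (G : GroupStructure p m) (x : Fin p → ℝ) (i : Fin m) :
    gnorm G x i = ‖WithLp.toLp 2 (fun j : G.J i => x j)‖ := by
  rw [EuclideanSpace.norm_eq, gnorm, ← Finset.sum_coe_sort]
  simp

theorem abs_gnorm_sub_gnorm_le (G : GroupStructure p m) (x y : Fin p → ℝ) (i : Fin m) :
    |gnorm G x i - gnorm G y i| ≤ gnorm G (x - y) i := by
  simp only [gnorm_eq_norm]
  exact abs_norm_sub_norm_le _ _

theorem gnorm_eq_zero_of_notMem_gsupp (G : GroupStructure p m) {x : Fin p → ℝ} {i : Fin m}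
    (hi : i ∉ gsupp G x) : gnorm G x i = 0 := by
  have h : ∀ j ∈ G.J i, x j = 0 := by simpa [gsupp] using hi
  rw [gnorm, Finset.sum_eq_zero fun j hj => by simp [h j hj], Real.sqrt_zero]

theorem gnorm_sub_of_notMem_gsupp (G : GroupStructure p m) (x : Fin p → ℝ) {y : Fin p → ℝ}
    {i : Fin m} (hi : i ∉ gsupp G y) : gnorm G (x - y) i = gnorm G x i := by
  have h : ∀ j ∈ G.J i, y j = 0 := by simpa [gsupp] using hi
  rw [gnorm, gnorm, Finset.sum_congr rfl fun j hj => by rw [Pi.sub_apply, h j hj, sub_zero]]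

theorem gnorm_le_gsup (G : GroupStructure p m) (x : Fin p → ℝ) (i : Fin m) :
    gnorm G x i ≤ gsup G x :=
  le_ciSup (Set.finite_range _).bddAbove i

theorem GroupStructure.sum_sum_eq (G : GroupStructure p m) (f : Fin p → ℝ) :
    ∑ i, ∑ j ∈ G.J i, f j = ∑ j, f j := by
  rw [← Finset.sum_biUnion fun i _ j _ hij => G.disj i j hij]
  congr 1
  ext k
  simpa using G.cover k

theorem sum_sq_gnorm (G : GroupStructure p m) (x : Fin p → ℝ) :
    ∑ i, gnorm G x i ^ 2 = enorm' x ^ 2 := by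
  rw [enorm', Real.sq_sqrt (Finset.sum_nonneg fun _ _ => sq_nonneg _), ← G.sum_sum_eq]
  exact Finset.sum_congr rfl fun i _ => Real.sq_sqrt (Finset.sum_nonneg fun _ _ => sq_nonneg _)

theorem sum_sq_gnorm_le (G : GroupStructure p m) (x : Fin p → ℝ) (S : Finset (Fin m)) :
    ∑ i ∈ S, gnorm G x i ^ 2 ≤ enorm' x ^ 2 := by
  rw [← sum_sq_gnorm G]
  exact Finset.sum_le_univ_sum_of_nonneg fun _ => sq_nonneg _

theorem sum_gnorm_le_sqrt_card_mul (G : GroupStructure p m) (x : Fin p → ℝ)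
    (S : Finset (Fin m)) : ∑ i ∈ S, gnorm G x i ≤ Real.sqrt S.card * enorm' x := by
  refine le_of_sq_le_sq ?_ (mul_nonneg (Real.sqrt_nonneg _) (Real.sqrt_nonneg _))
  rw [mul_pow, Real.sq_sqrt (Nat.cast_nonneg _)]
  exact sq_sum_le_card_mul_sum_sq.trans
    (mul_le_mul_of_nonneg_left (sum_sq_gnorm_le G x S) (Nat.cast_nonneg _))

theorem sum_mul_le_gsup_mul_sum_gnorm (G : GroupStructure p m) (e z : Fin p → ℝ) :
    ∑ j, e j * z j ≤ ∑ i, gsup G e * gnorm G z i := by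
  rw [← G.sum_sum_eq]
  refine Finset.sum_le_sum fun i _ => (Real.sum_mul_le_sqrt_mul_sqrt _ _ _).trans ?_
  exact mul_le_mul_of_nonneg_right (gnorm_le_gsup G e i) (gnorm_nonneg G z i)

/-- Expansion of the least-squares loss around the true vector. -/
theorem lsObj_sub_lsObj (A : Matrix (Fin n) (Fin p) ℝ) (x y : Fin p → ℝ) (ε : Fin n → ℝ) :
    lsObj A (A.mulVec y + ε) x - lsObj A (A.mulVec y + ε) y =
      1 / (2 * n) * enorm' (A.mulVec (x - y)) ^ 2 - ∑ j, epsHat A ε j * (x - y) j := by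
  have hswap : ∑ j, epsHat A ε j * (x - y) j = (1 / (n : ℝ)) * ∑ i, ε i * A.mulVec (x - y) i := by
    simp only [epsHat, Matrix.mulVec, dotProduct, Finset.mul_sum, Finset.sum_mul]
    rw [Finset.sum_comm]
    exact Finset.sum_congr rfl fun i _ => Finset.sum_congr rfl fun j _ => by ring
  rw [hswap, enorm', Real.sq_sqrt (Finset.sum_nonneg fun _ _ => sq_nonneg _), lsObj, lsObj,
    Finset.mul_sum, Finset.mul_sum, Finset.mul_sum, Finset.mul_sum, ← Finset.sum_sub_distrib,
    ← Finset.sum_sub_distrib]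
  refine Finset.sum_congr rfl fun i _ => ?_
  have h2 : (1 : ℝ) / n = 2 * (1 / (2 * n)) := by
    rw [one_div, one_div, mul_inv]; ring
  rw [Matrix.mulVec_sub, h2]
  simp only [Pi.add_apply, Pi.sub_apply]
  ring

/-- Error bound for one weighted group-Lasso step whose weights `v` are at most `tbar` outside a
small index set `S` containing the true group support. -/
theorem enorm_sub_le_of_weighted_step (G : GroupStructure p m) (A : Matrix (Fin n) (Fin p) ℝ)
    (xbar x : Fin p → ℝ) (ε : Fin n → ℝ) {tbar κ l lam : ℝ} (v : Fin m → ℝ) (S : Finset (Fin m))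
    (ht : tbar < 1) (hκ : 0 < κ) (hlam : 0 < lam)
    (hRSC : ∀ z ∈ coneC G tbar (gsupp G xbar) l,
      κ * (enorm' z) ^ 2 ≤ (1 / (2 * n)) * (enorm' (A.mulVec z)) ^ 2)
    (hopt : lsObj A (A.mulVec xbar + ε) x + lam * ∑ i, (1 - v i) * gnorm G x i ≤
      lsObj A (A.mulVec xbar + ε) xbar + lam * ∑ i, (1 - v i) * gnorm G xbar i)
    (hv : ∀ i, 0 ≤ v i ∧ v i ≤ 1) (hvS : ∀ i ∉ S, v i ≤ tbar)
    (hS : gsupp G xbar ⊆ S) (hSl : (S.card : ℝ) ≤ l)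
    (he : gsup G (epsHat A ε) * (3 - tbar) ≤ lam * (1 - tbar)) :
    enorm' (x - xbar) ≤ lam * (4 - 2 * tbar) / (κ * (3 - tbar)) * Real.sqrt l := by
  set z := x - xbar with hz
  set e := gsup G (epsHat A ε)
  have h3 : 0 < 3 - tbar := by linarith
  have hterm : ∀ i, e * gnorm G z i + lam * ((1 - v i) * gnorm G xbar i - (1 - v i) * gnorm G x i) ≤
      if i ∈ S then (e + lam) * gnorm G z i else (e - lam * (1 - tbar)) * gnorm G z i := by
    intro i
    have hzi := gnorm_nonneg G z i
    have h1v : 0 ≤ 1 - v i := by linarith [(hv i).2]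
    split_ifs with hi
    · have h1 : gnorm G xbar i - gnorm G x i ≤ gnorm G z i := by
        have := (abs_le.1 (abs_gnorm_sub_gnorm_le G x xbar i)).1
        linarith
      have h2 : (1 - v i) * (gnorm G xbar i - gnorm G x i) ≤ gnorm G z i :=
        (mul_le_mul_of_nonneg_left h1 h1v).trans
          (mul_le_of_le_one_left hzi (by linarith [(hv i).1]))
      nlinarith [mul_le_mul_of_nonneg_left h2 hlam.le]
    · have hi' : i ∉ gsupp G xbar := fun h => hi (hS h)
      rw [gnorm_eq_zero_of_notMem_gsupp G hi', ← gnorm_sub_of_notMem_gsupp G x hi', ← hz]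
      have h2 : (1 - tbar) * gnorm G z i ≤ (1 - v i) * gnorm G z i :=
        mul_le_mul_of_nonneg_right (by linarith [hvS i hi]) hzi
      nlinarith [mul_le_mul_of_nonneg_left h2 hlam.le]
  have hsum := Finset.sum_le_sum fun i (_ : i ∈ Finset.univ) => hterm i
  rw [Finset.sum_add_distrib, ← Finset.mul_sum (a := lam), Finset.sum_sub_distrib,
    Finset.sum_ite, ← Finset.mul_sum (a := e + lam), ← Finset.mul_sum (a := e - lam * (1 - tbar)),
    Finset.filter_mem_eq_inter,
    Finset.univ_inter, Finset.filter_notMem_eq_sdiff, ← Finset.compl_eq_univ_sdiff] at hsum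
  have hls := lsObj_sub_lsObj A x xbar ε
  have hcs := sum_mul_le_gsup_mul_sum_gnorm G (epsHat A ε) z
  rw [← hz] at hls
  set P := ∑ i ∈ S, gnorm G z i
  set Q := ∑ i ∈ Sᶜ, gnorm G z i
  have hP : 0 ≤ P := Finset.sum_nonneg fun i _ => gnorm_nonneg G z i
  have hQ : 0 ≤ Q := Finset.sum_nonneg fun i _ => gnorm_nonneg G z i
  have hmain : 1 / (2 * n) * enorm' (A.mulVec z) ^ 2 ≤
      (e + lam) * P + (e - lam * (1 - tbar)) * Q := by
    rw [mul_sub] at hsum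
    linarith
  have hlow : 0 ≤ 1 / (2 * (n : ℝ)) * enorm' (A.mulVec z) ^ 2 := by positivity
  have hcP : (e + lam) * (3 - tbar) * P ≤ lam * (4 - 2 * tbar) * P :=
    mul_le_mul_of_nonneg_right (by linarith) hP
  have hcQ : (e - lam * (1 - tbar)) * (3 - tbar) * Q ≤ -(lam * (1 - tbar) * (2 - tbar)) * Q :=
    mul_le_mul_of_nonneg_right (by linarith) hQ
  have hscaled : (3 - tbar) * (1 / (2 * n) * enorm' (A.mulVec z) ^ 2) ≤
      lam * (4 - 2 * tbar) * P - lam * (1 - tbar) * (2 - tbar) * Q := by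
    have := mul_le_mul_of_nonneg_left hmain h3.le
    linarith
  have hcone : z ∈ coneC G tbar (gsupp G xbar) l := by
    refine ⟨S, hS, hSl, ?_⟩
    rw [div_mul_eq_mul_div, le_div_iff₀ (by linarith)]
    have hpos : 0 < lam * (2 - tbar) := mul_pos hlam (by linarith)
    refine le_of_mul_le_mul_left ?_ hpos
    have := mul_nonneg h3.le hlow
    change lam * (2 - tbar) * (Q * (1 - tbar)) ≤ lam * (2 - tbar) * (2 * P)
    linarith
  have hz0 : 0 ≤ enorm' z := Real.sqrt_nonneg _
  have hPz : P ≤ Real.sqrt l * enorm' z :=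
    (sum_gnorm_le_sqrt_card_mul G z S).trans
      (mul_le_mul_of_nonneg_right (Real.sqrt_le_sqrt hSl) hz0)
  have hlt : 0 ≤ lam * (4 - 2 * tbar) := mul_nonneg hlam.le (by linarith)
  have hfin : (3 - tbar) * (κ * enorm' z ^ 2) ≤
      lam * (4 - 2 * tbar) * (Real.sqrt l * enorm' z) := by
    have h1 := mul_le_mul_of_nonneg_left (hRSC z hcone) h3.le
    have h2 := mul_le_mul_of_nonneg_left hPz hlt
    have h3 : 0 ≤ lam * (1 - tbar) * (2 - tbar) * Q :=
      mul_nonneg (mul_nonneg (mul_nonneg hlam.le (by linarith)) (by linarith)) hQ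
    linarith
  rw [div_mul_eq_mul_div, le_div_iff₀ (mul_pos hκ h3)]
  rcases hz0.eq_or_lt with h0 | h0
  · rw [← h0, zero_mul]
    exact mul_nonneg hlt (Real.sqrt_nonneg _)
  · refine le_of_mul_le_mul_right ?_ h0
    linarith

/-- A minimizer of `φ - s * id` over `[0, 1]` exceeding a point `t` forces `s` to dominate every
subgradient of `φ` at `t`. -/
theorem le_of_mem_subdiff_of_lt_minimizer {φ : ℝ → EReal} {c s t u : ℝ}
    (hbot : φ t ≠ ⊥) (htop : φ t ≠ ⊤) (hc : c ∈ subdiff φ t)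
    (hu : φ u + ((s * t : ℝ) : EReal) ≤ φ t + ((s * u : ℝ) : EReal)) (htu : t < u) : c ≤ s := by
  have h := (add_le_add_left (hc u) ((s * t : ℝ) : EReal)).trans hu
  lift φ t to ℝ using ⟨htop, hbot⟩ with a
  norm_cast at h
  refine le_of_mul_le_mul_right ?_ (sub_pos.2 htu)
  linarith

theorem ne_top_of_mem_subdiff {φ : ℝ → EReal} {c t u : ℝ} (hc : c ∈ subdiff φ t)
    (hu : φ u ≠ ⊤) : φ t ≠ ⊤ := by
  intro h
  have := hc u
  rw [h, EReal.top_add_coe] at this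
  exact hu (top_le_iff.1 this)

/-- Few groups outside the true support can have large blocks in an accurate estimate. -/
theorem card_union_filter_le (G : GroupStructure p m) (x xbar : Fin p → ℝ) {a B : ℝ}
    (w : Fin m → ℝ) (tbar : ℝ) (ha : 0 < a)
    (hbig : ∀ i, tbar < w i → a ≤ gnorm G x i)
    (hB : enorm' (x - xbar) ≤ B * Real.sqrt ((3 / 2 : ℝ) * (gsupp G xbar).card))
    (hBa : Real.sqrt 3 * B ≤ a) :
    ((gsupp G xbar ∪ Finset.univ.filter (fun i => tbar < w i)).card : ℝ) ≤
      (3 / 2 : ℝ) * (gsupp G xbar).card := by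
  set T := Finset.univ.filter (fun i => tbar < w i) \ gsupp G xbar
  have hcard : (gsupp G xbar ∪ Finset.univ.filter (fun i => tbar < w i)).card =
      (gsupp G xbar).card + T.card := by
    rw [← Finset.union_sdiff_self_eq_union, Finset.card_union_of_disjoint Finset.disjoint_sdiff]
  rw [hcard]
  push_cast
  set r : ℝ := ((gsupp G xbar).card : ℝ)
  have hr : 0 ≤ r := Nat.cast_nonneg _
  have hT : T.card * a ^ 2 ≤ enorm' (x - xbar) ^ 2 := by
    refine le_trans ?_ (sum_sq_gnorm_le G (x - xbar) T)
    rw [← nsmul_eq_mul]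
    refine Finset.card_nsmul_le_sum _ _ _ fun i hi => ?_
    have hi' := Finset.mem_sdiff.1 hi
    rw [gnorm_sub_of_notMem_gsupp G x hi'.2]
    exact pow_le_pow_left₀ ha.le (hbig i (Finset.mem_filter.1 hi'.1).2) 2
  have hle : Real.sqrt 3 * enorm' (x - xbar) ≤ a * Real.sqrt (3 / 2 * r) :=
    calc _ ≤ Real.sqrt 3 * (B * Real.sqrt (3 / 2 * r)) :=
          mul_le_mul_of_nonneg_left hB (Real.sqrt_nonneg _)
      _ = Real.sqrt 3 * B * Real.sqrt (3 / 2 * r) := by ring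
      _ ≤ _ := mul_le_mul_of_nonneg_right hBa (Real.sqrt_nonneg _)
  have hnn : 0 ≤ enorm' (x - xbar) := Real.sqrt_nonneg _
  have hsq := pow_le_pow_left₀ (mul_nonneg (Real.sqrt_nonneg 3) hnn) hle 2
  rw [mul_pow, mul_pow, Real.sq_sqrt zero_le_three,
    Real.sq_sqrt (show 0 ≤ 3 / 2 * r by positivity)] at hsq
  have : (T.card : ℝ) ≤ r / 2 := by
    refine le_of_mul_le_mul_right ?_ (pow_pos ha 2)
    linarith
  linarith

/-- **Theorem 4.1.** Under the RSC assumption and the stated choices of `ν` and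
`ρ`, the GEP-MSCRA iterates satisfy
`‖x¹ - x̄‖ ≤ ν⁻¹(4-2tbar)/(κ(3-tbar))·√(1.5 r̄)` and, for `k ≥ 2`,
`‖x^k - x̄‖ ≤ ρν⁻¹(4-2tbar)/(κ(3-tbar))·√(1.5 r̄)`. -/
theorem GEP_MSCRA_error_bounds {p m n : ℕ} (G : GroupStructure p m)
    (A : Matrix (Fin n) (Fin p) ℝ) (xbar : Fin p → ℝ) (ε : Fin n → ℝ) (b : Fin n → ℝ)
    (hb : b = A.mulVec xbar + ε) (R : ℝ) (hR : 0 < R) (hxbar : xbar ∈ OmegaSet p R)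
    (φ : ℝ → EReal) (tstar tbar : ℝ) (hφ : MemPhi φ tstar) (htbar : IsTbar φ tstar tbar)
    (ν ρ : ℝ) (hν : 0 < ν) (hρ : 0 < ρ)
    -- the GEP-MSCRA iterates
    (x : ℕ → Fin p → ℝ) (w : ℕ → Fin m → ℝ)
    (hw0 : ∀ i, 0 ≤ w 0 i ∧ w 0 i ≤ tbar)
    (hxk : ∀ k : ℕ, 1 ≤ k → x k ∈ OmegaSet p R ∧ ∀ y ∈ OmegaSet p R,
      lsObj A b (x k) +
          (if k = 1 then ν⁻¹ else ρ / ν) * ∑ i, (1 - w (k - 1) i) * gnorm G (x k) i ≤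
        lsObj A b y + (if k = 1 then ν⁻¹ else ρ / ν) * ∑ i, (1 - w (k - 1) i) * gnorm G y i)
    (hwk : ∀ k : ℕ, 1 ≤ k → ∀ i, w k i ∈ Set.Icc (0:ℝ) 1 ∧ ∀ t ∈ Set.Icc (0:ℝ) 1,
      φ (w k i) + ((ρ * t * gnorm G (x k) i : ℝ) : EReal) ≤
        φ t + ((ρ * w k i * gnorm G (x k) i : ℝ) : EReal))
    -- restricted strong convexity and the parameter choices
    (κ : ℝ) (hκ : 0 < κ)
    (hRSC : ∀ z ∈ coneC G tbar (gsupp G xbar) ((3 / 2 : ℝ) * (gsupp G xbar).card),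
      κ * (enorm' z) ^ 2 ≤ (1 / (2 * n)) * (enorm' (A.mulVec z)) ^ 2)
    (hν1 : Real.sqrt 3 * (4 - 2 * tbar) * (1 - tstar) / ((3 - tbar) * κ) ≤ ν)
    (hν2 : ν ≤ (1 - tbar) / ((3 - tbar) * gsup G (epsHat A ε)))
    (hρ1 : ν * (3 - tbar) * gsup G (epsHat A ε) / (1 - tbar) ≤ ρ)
    (hρ2 : ρ ≤ Real.sqrt ((3 - tbar) * κ * ν /
      (Real.sqrt 3 * (4 - 2 * tbar) * (1 - tstar)))) :
    enorm' (x 1 - xbar) ≤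
      ν⁻¹ * (4 - 2 * tbar) / (κ * (3 - tbar)) *
        Real.sqrt ((3 / 2 : ℝ) * (gsupp G xbar).card) ∧
    ∀ k : ℕ, 2 ≤ k → enorm' (x k - xbar) ≤
      ρ * ν⁻¹ * (4 - 2 * tbar) / (κ * (3 - tbar)) *
        Real.sqrt ((3 / 2 : ℝ) * (gsupp G xbar).card) := by
  subst hb
  obtain ⟨⟨htt, ht1⟩, hsub, -⟩ := htbar
  have hts : 0 < 1 - tstar := by linarith
  have h3 : 0 < 3 - tbar := by linarith
  have h4 : 0 < 4 - 2 * tbar := by linarith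
  have he0 : 0 ≤ gsup G (epsHat A ε) := Real.iSup_nonneg fun i => gnorm_nonneg G _ i
  have he : 0 < gsup G (epsHat A ε) := by
    refine he0.lt_of_ne fun h => ?_
    rw [← h, mul_zero, div_zero] at hν2
    linarith
  set e := gsup G (epsHat A ε)
  set r : ℝ := ((gsupp G xbar).card : ℝ)
  have hr : 0 ≤ r := Nat.cast_nonneg _
  set lam : ℕ → ℝ := fun k => if k = 1 then ν⁻¹ else ρ / ν with hlamdef
  have hlam : ∀ k, 0 < lam k := by
    intro k
    simp only [hlamdef]
    split_ifs <;> positivity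
  have helam : ∀ k, e * (3 - tbar) ≤ lam k * (1 - tbar) := by
    intro k
    simp only [hlamdef]
    split_ifs
    · rw [le_div_iff₀ (mul_pos h3 he)] at hν2
      rw [← div_eq_inv_mul, le_div_iff₀ hν]
      linarith
    · rw [div_le_iff₀ (by linarith)] at hρ1
      rw [div_mul_eq_mul_div, le_div_iff₀ hν]
      linarith
  set D := (4 - 2 * tbar) / (κ * (3 - tbar)) with hD
  have hDpos : 0 < D := div_pos h4 (mul_pos hκ h3)
  have hs3 : 0 < Real.sqrt 3 := Real.sqrt_pos.2 (by norm_num)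
  have hqpos : 0 < Real.sqrt 3 * D * (1 - tstar) := mul_pos (mul_pos hs3 hDpos) hts
  have hqν : Real.sqrt 3 * D * (1 - tstar) ≤ ν := by
    refine le_of_eq_of_le ?_ hν1
    rw [hD]
    field_simp
  have hρq : ρ ^ 2 * (Real.sqrt 3 * D * (1 - tstar)) ≤ ν := by
    have hq : (3 - tbar) * κ * ν / (Real.sqrt 3 * (4 - 2 * tbar) * (1 - tstar)) =
        ν / (Real.sqrt 3 * D * (1 - tstar)) := by
      rw [hD]
      field_simp
    rwa [hq, Real.le_sqrt hρ.le (div_pos hν hqpos).le, le_div_iff₀ hqpos] at hρ2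
  have hlamq : ∀ k, Real.sqrt 3 * (lam k * D) ≤ 1 / (ρ * (1 - tstar)) := by
    intro k
    rw [le_div_iff₀ (mul_pos hρ hts)]
    simp only [hlamdef]
    split_ifs
    · have h1 : ρ * (Real.sqrt 3 * D * (1 - tstar)) ≤ ν := by
        refine le_of_sq_le_sq ?_ hν.le
        rw [mul_pow]
        nlinarith [mul_le_mul hρq hqν hqpos.le hν.le]
      calc _ = ρ * (Real.sqrt 3 * D * (1 - tstar)) / ν := by field_simp
        _ ≤ 1 := (div_le_one hν).2 h1
    · calc _ = ρ ^ 2 * (Real.sqrt 3 * D * (1 - tstar)) / ν := by field_simp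
        _ ≤ 1 := (div_le_one hν).2 hρq
  have hstep : ∀ k, 1 ≤ k → ∀ S : Finset (Fin m), gsupp G xbar ⊆ S → (S.card : ℝ) ≤ 3 / 2 * r →
      (∀ i, 0 ≤ w (k - 1) i ∧ w (k - 1) i ≤ 1) → (∀ i ∉ S, w (k - 1) i ≤ tbar) →
      enorm' (x k - xbar) ≤ lam k * D * Real.sqrt (3 / 2 * r) := by
    intro k hk S hS hSr hw hwS
    rw [hD, ← mul_div_assoc]
    exact enorm_sub_le_of_weighted_step G A xbar (x k) ε (w (k - 1)) S ht1 hκ (hlam k) hRSC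
      ((hxk k hk).2 xbar hxbar) hw hwS hS hSr (helam k)
  have htop : φ tbar ≠ ⊤ := ne_top_of_mem_subdiff hsub (u := 1) (by
    rw [hφ.phiOne]; exact EReal.coe_ne_top 1)
  have hbig : ∀ k, 1 ≤ k → ∀ i, tbar < w k i → 1 / (ρ * (1 - tstar)) ≤ gnorm G (x k) i := by
    intro k hk i hi
    have hmin := (hwk k hk i).2 tbar ⟨hφ.tstarMem.1.trans htt, ht1.le⟩
    rw [mul_right_comm, mul_right_comm ρ (w k i)] at hmin
    have := le_of_mem_subdiff_of_lt_minimizer (hφ.proper _) htop hsub hmin hi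
    rw [div_le_iff₀ hts] at this
    rw [div_le_iff₀ (mul_pos hρ hts)]
    linarith
  have hall : ∀ k, 1 ≤ k → enorm' (x k - xbar) ≤ lam k * D * Real.sqrt (3 / 2 * r) := by
    intro k hk
    induction k, hk using Nat.le_induction with
    | base =>
      refine hstep 1 le_rfl (gsupp G xbar) subset_rfl (by linarith) (fun i => ?_) fun i _ => ?_
      · exact ⟨(hw0 i).1, (hw0 i).2.trans ht1.le⟩
      · exact (hw0 i).2
    | succ k hk ih =>
      refine hstep (k + 1) (by omega) _ Finset.subset_union_left
        (card_union_filter_le G (x k) xbar (w k) tbar (by positivity) (hbig k hk) ih (hlamq k))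
        (fun i => (hwk k hk i).1) fun i hi => ?_
      by_contra! h
      exact hi (Finset.mem_union_right _ (Finset.mem_filter.2 ⟨Finset.mem_univ i, h⟩))
  refine ⟨?_, fun k hk => ?_⟩
  · have := hall 1 le_rfl
    rwa [hD, ← mul_div_assoc] at this
  · have := hall k (by omega)
    simp only [hlamdef, if_neg (show k ≠ 1 by omega)] at this
    rwa [hD, ← mul_div_assoc, div_eq_mul_inv ρ] at this

end
end
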